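/- arXiv:1901.07917 — 2 statements merged into one kernel-verified Lean document; each statement's English description precedes it below -/
import Mathlib

section
/- (Approximation lemma) Let f₁, f₂ be almost periodic functions on vertical strips U₁, U₂ with U₁ ∩ U₂ ≠ ∅. Suppose for every open set E ⊆ (α,β) ⊆ (α₁,β₁)∩(α₂,β₂), the union over σ ∈ E of the image of t ↦ f₁(σ+it) equals the corresponding union for f₂. Then for every w with Re w ∈ (α,β), there exist sequences {wₘ} ⊆ U₁∩U₂ with wₘ → w and {tₘ} ⊆ ℝ such that f₁(wₘ + i tₘ) = f₂(w) for each m ≥ 1. -/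
noncomputable section

/-- Bohr almost periodicity of an analytic function on the open vertical strip
`{s : α < Re s < β}`: `f` is analytic there and, for every `ε > 0` and every reduced
(closed) substrip, there is a relatively dense set of `ε`-almost periods. -/
def IsAlmostPeriodic (α β : ℝ) (f : ℂ → ℂ) : Prop :=
  (∀ s : ℂ, α < s.re → s.re < β → DifferentiableAt ℂ f s) ∧
  ∀ ε : ℝ, 0 < ε → ∀ σ₁ σ₂ : ℝ, α < σ₁ → σ₁ ≤ σ₂ → σ₂ < β →
    ∃ l : ℝ, 0 < l ∧ ∀ t₀ : ℝ, ∃ τ : ℝ, τ ∈ Set.Icc t₀ (t₀ + l) ∧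
      ∀ s : ℂ, σ₁ ≤ s.re → s.re ≤ σ₂ → ‖f (s + Complex.I * τ) - f s‖ ≤ ε

/-- The set of values taken by `f` on the vertical strip over `E ⊆ ℝ`. -/
def valueSet (f : ℂ → ℂ) (E : Set ℝ) : Set ℂ :=
  {z : ℂ | ∃ σ ∈ E, ∃ t : ℝ, f ((σ : ℂ) + (t : ℂ) * Complex.I) = z}

/-- Approximation lemma: if `f₁` and `f₂` are almost periodic on strips `U₁`, `U₂` with
`U₁ ∩ U₂ ≠ ∅` and take the same set of values on the strip over every open
`E ⊆ (α,β) ⊆ (α₁,β₁) ∩ (α₂,β₂)`, then for every `w` with `Re w ∈ (α,β)` there are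
`wₘ ∈ U₁ ∩ U₂` with `wₘ → w` and reals `tₘ` such that `f₁ (wₘ + i tₘ) = f₂ w`. -/
theorem approximation_lemma (f₁ f₂ : ℂ → ℂ) (α₁ β₁ α₂ β₂ α β : ℝ)
    (h₁ : IsAlmostPeriodic α₁ β₁ f₁) (h₂ : IsAlmostPeriodic α₂ β₂ f₂)
    (hne : (Set.Ioo α₁ β₁ ∩ Set.Ioo α₂ β₂).Nonempty)
    (hsub : Set.Ioo α β ⊆ Set.Ioo α₁ β₁ ∩ Set.Ioo α₂ β₂)
    (hval : ∀ E : Set ℝ, IsOpen E → E ⊆ Set.Ioo α β → valueSet f₁ E = valueSet f₂ E)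
    (w : ℂ) (hw : w.re ∈ Set.Ioo α β) :
    ∃ (wseq : ℕ → ℂ) (t : ℕ → ℝ),
      (∀ m : ℕ, (wseq m).re ∈ Set.Ioo α₁ β₁ ∩ Set.Ioo α₂ β₂) ∧
      Filter.Tendsto wseq Filter.atTop (nhds w) ∧
      ∀ m : ℕ, f₁ (wseq m + Complex.I * (t m : ℂ)) = f₂ w := by
  have hstep (m : ℕ) : ∃ σ ∈ Set.Ioo α β ∩ Metric.ball w.re (1 / ((m : ℝ) + 1)),
      ∃ t : ℝ, f₁ ((σ : ℂ) + (t : ℂ) * Complex.I) = f₂ w := by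
    have hmem : f₂ w ∈ valueSet f₂ (Set.Ioo α β ∩ Metric.ball w.re (1 / ((m : ℝ) + 1))) :=
      ⟨w.re, ⟨hw, Metric.mem_ball_self Nat.one_div_pos_of_nat⟩, w.im, by rw [Complex.re_add_im]⟩
    rwa [← hval _ (isOpen_Ioo.inter Metric.isOpen_ball) Set.inter_subset_left] at hmem
  choose σ hσ t ht using hstep
  have hlim : Filter.Tendsto σ Filter.atTop (nhds w.re) :=
    tendsto_iff_dist_tendsto_zero.2 <|
      squeeze_zero (fun _ => dist_nonneg) (fun m => (Metric.mem_ball.1 (hσ m).2).le)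
        tendsto_one_div_add_atTop_nhds_zero_nat
  refine ⟨fun m => (σ m : ℂ) + (w.im : ℂ) * Complex.I, fun m => t m - w.im,
    fun m => ?_, ?_, fun m => ?_⟩
  · simpa using hsub (hσ m).1
  · have h := ((Complex.continuous_ofReal.tendsto w.re).comp hlim).add_const
      ((w.im : ℂ) * Complex.I)
    rwa [Complex.re_add_im] at h
  · rw [← ht m]
    congr 1
    push_cast
    ring
end
end

section
/- (Main theorem, forward direction) If f₁ and f₂ are *∼-equivalent almost periodic functions on a common vertical strip U = {σ+it : α < σ < β}, then for every open set E ⊆ (α, β), the set of values ⋃_{σ∈E}{f₁(σ+it) : t∈ℝ} equals ⋃_{σ∈E}{f₂(σ+it) : t∈ℝ}. -/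
noncomputable section

/-- `f` has mean (Fourier) coefficient `c` at frequency `μ` on the vertical line `Re s = σ`:
`(1/2T) ∫_{-T}^{T} f(σ+it) e^{-iμt} dt → c` as `T → ∞`. -/
def HasMeanCoeff (f : ℂ → ℂ) (σ μ : ℝ) (c : ℂ) : Prop :=
  Filter.Tendsto
    (fun T : ℝ => (1 / (2 * (T : ℂ))) *
      ∫ t in (-T)..T, f ((σ : ℂ) + (t : ℂ) * Complex.I) * Complex.exp (-(Complex.I * μ * t)))
    Filter.atTop (nhds c)

/-- `∑ⱼ a j · e^{lam j · s}` is the Dirichlet series of `f` on the strip `α < Re s < β`: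
on every vertical line of the strip, the Fourier coefficient of `f` at frequency `lam j`
is `a j · e^{lam j · σ}`, and the Fourier coefficients at all other frequencies vanish. -/
def HasDirichletSeries (f : ℂ → ℂ) (α β : ℝ) (lam : ℕ → ℝ) (a : ℕ → ℂ) : Prop :=
  ∀ σ : ℝ, α < σ → σ < β →
    (∀ j : ℕ, HasMeanCoeff f σ (lam j) (a j * Complex.exp ((lam j : ℂ) * (σ : ℂ)))) ∧
    (∀ μ : ℝ, (∀ j : ℕ, lam j ≠ μ) → HasMeanCoeff f σ μ 0)

/-- `*`-equivalence of coefficient sequences. -/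
def StarEquiv (lam : ℕ → ℝ) (a b : ℕ → ℂ) : Prop :=
  ∀ n : ℕ, 1 ≤ n →
    ∃ ψ : (Submodule.span ℚ (lam '' {j : ℕ | j < n})) →ₗ[ℚ] ℝ,
      ∀ j : ℕ, ∀ hj : j < n,
        b j = a j * Complex.exp
          (Complex.I * (ψ ⟨lam j, Submodule.subset_span (Set.mem_image_of_mem lam hj)⟩))

section Auxiliary

open Filter Topology Complex

/-- The mean value `lim_{T → ∞} (1 / (2 * T)) ∫_{-T}^{T} g` exists and equals `c`. -/
def HasMean (g : ℝ → ℂ) (c : ℂ) : Prop :=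
  Tendsto (fun T : ℝ => (1 / (2 * (T : ℂ))) * ∫ t in (-T)..T, g t) atTop (𝓝 c)

lemma HasMean.const_mul {g : ℝ → ℂ} {c : ℂ} (hg : HasMean g c) (a : ℂ) :
    HasMean (fun t => a * g t) (a * c) := by
  refine (Tendsto.const_mul a hg).congr fun T => ?_
  rw [intervalIntegral.integral_const_mul]
  ring

lemma HasMean.sub {g h : ℝ → ℂ} {c d : ℂ} (hg : HasMean g c) (hh : HasMean h d)
    (cg : Continuous g) (ch : Continuous h) : HasMean (fun t => g t - h t) (c - d) := by
  refine (Tendsto.sub hg hh).congr fun T => ?_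
  rw [intervalIntegral.integral_sub (cg.intervalIntegrable _ _) (ch.intervalIntegrable _ _), mul_sub]

lemma HasMean.sum {ι : Type*} (s : Finset ι) {g : ι → ℝ → ℂ} {c : ι → ℂ}
    (hg : ∀ i ∈ s, HasMean (g i) (c i)) (cg : ∀ i ∈ s, Continuous (g i)) :
    HasMean (fun t => ∑ i ∈ s, g i t) (∑ i ∈ s, c i) := by
  refine (tendsto_finsetSum s hg).congr fun T => ?_
  rw [intervalIntegral.integral_finsetSum fun i hi => (cg i hi).intervalIntegrable _ _,
    Finset.mul_sum]

lemma norm_mean_le {g : ℝ → ℂ} {B T : ℝ} (hT : 0 < T) (hB : ∀ t, ‖g t‖ ≤ B) :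
    ‖(1 / (2 * (T : ℂ))) * ∫ t in (-T)..T, g t‖ ≤ B := by
  have h1 := intervalIntegral.norm_integral_le_of_norm_le_const (a := -T) (b := T) (f := g) (C := B)
    fun t _ => hB t
  rw [norm_mul]
  have h2 : ‖1 / (2 * (T : ℂ))‖ = 1 / (2 * T) := by simp [abs_of_pos hT]
  rw [h2, div_mul_eq_mul_div, one_mul, div_le_iff₀ (by positivity)]
  refine h1.trans (le_of_eq ?_)
  rw [abs_of_pos (by linarith)]
  ring

lemma HasMean.norm_le {g : ℝ → ℂ} {c : ℂ} {B : ℝ} (hg : HasMean g c) (hB : ∀ t, ‖g t‖ ≤ B) :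
    ‖c‖ ≤ B :=
  le_of_tendsto (Tendsto.norm hg) <| (eventually_gt_atTop 0).mono fun _ hT => norm_mean_le hT hB

lemma hasMean_one : HasMean (fun _ => 1) 1 := by
  refine tendsto_const_nhds.congr' ?_
  filter_upwards [eventually_gt_atTop 0] with T hT
  have : (T : ℂ) ≠ 0 := by exact_mod_cast hT.ne'
  simp
  field_simp
  norm_num

lemma hasMean_exp_of_ne_zero {μ : ℝ} (hμ : μ ≠ 0) : HasMean (fun t => exp (I * μ * t)) 0 := by
  have hc : I * (μ : ℂ) ≠ 0 := mul_ne_zero I_ne_zero (by exact_mod_cast hμ)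
  refine squeeze_zero_norm' (a := fun T : ℝ => (1 / |μ|) * T⁻¹) ?_ ?_
  · filter_upwards [eventually_gt_atTop 0] with T hT
    rw [integral_exp_mul_complex hc, norm_mul]
    have h1 : ‖exp (I * μ * (T : ℝ)) - exp (I * μ * ((-T : ℝ) : ℂ))‖ ≤ 2 := by
      refine (norm_sub_le _ _).trans (le_of_eq ?_)
      rw [norm_exp, norm_exp]
      simp
      norm_num
    have h2 : ‖I * (μ : ℂ)‖ = |μ| := by simp
    have h3 : ‖1 / (2 * (T : ℂ))‖ = 1 / (2 * T) := by simp [abs_of_pos hT]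
    rw [h3, norm_div, h2]
    have : 0 < |μ| := abs_pos.mpr hμ
    calc _ ≤ 1 / (2 * T) * (2 / |μ|) := by gcongr
      _ = _ := by field_simp
  · simpa using tendsto_inv_atTop_zero.const_mul (1 / |μ|)

lemma hasMean_exp (μ : ℝ) : HasMean (fun t => exp (I * μ * t)) (if μ = 0 then 1 else 0) := by
  split_ifs with h
  · simpa [h] using hasMean_one
  · exact hasMean_exp_of_ne_zero h

section Kronecker

variable {ι : Type*} [Fintype ι]

/-- The `p`-th power of an exponential sum, expanded over words of length `p`. -/
lemma expSum_pow (lam θ : ι → ℝ) (p : ℕ) (t : ℝ) :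
    (∑ j, exp (I * (lam j * t - θ j))) ^ p =
      ∑ v : Fin p → ι, exp (I * ((∑ k, lam (v k) : ℝ) * t - (∑ k, θ (v k) : ℝ))) := by
  classical
  have := Finset.prod_univ_sum (fun _ : Fin p => (Finset.univ : Finset ι))
    (fun _ j => exp (I * (lam j * t - θ j)))
  rw [Finset.prod_const, Finset.card_univ, Fintype.card_fin, Fintype.piFinset_univ] at this
  rw [this]
  refine Finset.sum_congr rfl fun v _ => ?_
  rw [← exp_sum]
  congr 1
  push_cast
  rw [← Finset.mul_sum, Finset.sum_sub_distrib, Finset.sum_mul]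

lemma sum_comp_eq_sum_card_fiber [DecidableEq ι] {p : ℕ} (v : Fin p → ι) (x : ι → ℝ) :
    ∑ k, x (v k) = ∑ j, ((Finset.univ.filter fun k => v k = j).card : ℝ) * x j := by
  rw [← Finset.sum_fiberwise Finset.univ v (fun k => x (v k))]
  refine Finset.sum_congr rfl fun j _ => ?_
  rw [Finset.sum_congr rfl (g := fun _ => x j) (by simp +contextual)]
  simp

/-- Number of pairs of words of length `p` with the same letter counts. -/
lemma card_pow_le_card_filter_eq [DecidableEq ι] (x : ι → ℝ) (p : ℕ) :
    ((Fintype.card ι : ℝ) ^ p) ^ 2 ≤ ((p : ℝ) + 1) ^ (Fintype.card ι) *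
      ∑ v : Fin p → ι, ∑ w : Fin p → ι, if ∑ k, x (v k) = ∑ k, x (w k) then (1 : ℝ) else 0 := by
  let cnt : (Fin p → ι) → ι → Fin (p + 1) := fun v j =>
    ⟨(Finset.univ.filter fun k => v k = j).card,
      Nat.lt_succ_of_le ((Finset.card_le_univ _).trans (by simp))⟩
  have hcnt : ∀ v w, cnt v = cnt w → ∑ k, x (v k) = ∑ k, x (w k) := by
    intro v w h
    rw [sum_comp_eq_sum_card_fiber, sum_comp_eq_sum_card_fiber]
    refine Finset.sum_congr rfl fun j _ => ?_
    have := congrArg Fin.val (congrFun h j)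
    simp only [cnt] at this
    rw [this]
  have h1 : ∑ c : ι → Fin (p + 1), ∑ v : Fin p → ι, (if cnt v = c then (1 : ℝ) else 0)
      = (Fintype.card ι : ℝ) ^ p := by
    rw [Finset.sum_comm]
    simp
  have h2 := sq_sum_le_card_mul_sum_sq (s := (Finset.univ : Finset (ι → Fin (p + 1))))
    (f := fun c => ∑ v : Fin p → ι, (if cnt v = c then (1 : ℝ) else 0))
  rw [h1, Finset.card_univ, Fintype.card_fun, Fintype.card_fin] at h2
  push_cast at h2
  refine h2.trans ?_
  gcongr
  simp_rw [sq, Finset.sum_mul_sum]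
  rw [Finset.sum_comm]
  refine Finset.sum_le_sum fun v _ => ?_
  rw [Finset.sum_comm]
  refine Finset.sum_le_sum fun w _ => ?_
  have : ∀ c, ((if cnt v = c then (1 : ℝ) else 0) * if cnt w = c then (1 : ℝ) else 0) =
      if cnt v = c then (if cnt w = cnt v then 1 else 0) else 0 := by
    intro c
    by_cases h : cnt v = c
    · subst h; simp
    · simp [h]
  simp_rw [this]
  rw [Finset.sum_ite_eq]
  simp only [Finset.mem_univ, if_true]
  split_ifs with h h' h'
  · exact le_rfl
  · exact absurd (hcnt _ _ h).symm h'
  · exact zero_le_one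
  · exact le_rfl

/-- If every integral relation between the frequencies is a relation between the phases, then the
exponential sum comes arbitrarily close to its trivial bound. -/
lemma exists_lt_norm_expSum [Nonempty ι] (lam θ : ι → ℝ)
    (hrel : ∀ k : ι → ℤ, ∑ j, (k j : ℝ) * lam j = 0 → ∑ j, (k j : ℝ) * θ j = 0)
    {r : ℝ} (hr : r < Fintype.card ι) :
    ∃ t : ℝ, r < ‖∑ j, exp (I * (lam j * t - θ j))‖ := by
  classical
  by_contra! hcon
  have hr0 : 0 ≤ r := (norm_nonneg _).trans (hcon 0)
  set N : ℝ := (Fintype.card ι : ℝ) with hN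
  have hN0 : 0 < N := by rw [hN]; exact_mod_cast Fintype.card_pos
  have hθ : ∀ (p : ℕ) (v w : Fin p → ι), ∑ k, lam (v k) = ∑ k, lam (w k) →
      ∑ k, θ (v k) = ∑ k, θ (w k) := by
    intro p v w h
    rw [sum_comp_eq_sum_card_fiber v, sum_comp_eq_sum_card_fiber w, ← sub_eq_zero,
      ← Finset.sum_sub_distrib] at h ⊢
    have := hrel (fun j => ((Finset.univ.filter fun k => v k = j).card : ℤ) -
      ((Finset.univ.filter fun k => w k = j).card : ℤ))
    push_cast at this
    simp_rw [sub_mul] at this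
    exact this h
  have key : ∀ p : ℕ, (N ^ p) ^ 2 ≤ ((p : ℝ) + 1) ^ (Fintype.card ι) * (r ^ p) ^ 2 := by
    intro p
    refine (card_pow_le_card_filter_eq lam p).trans ?_
    gcongr
    set Z : ℝ := ∑ v : Fin p → ι, ∑ w : Fin p → ι,
      if ∑ k, lam (v k) = ∑ k, lam (w k) then (1 : ℝ) else 0
    have hmean : HasMean (fun t => ∑ v : Fin p → ι, ∑ w : Fin p → ι,
        exp (-(I * ((∑ k, θ (v k) : ℝ) - (∑ k, θ (w k) : ℝ)))) *
          exp (I * ((∑ k, lam (v k) - ∑ k, lam (w k) : ℝ) : ℂ) * t)) (Z : ℂ) := by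
      have : (Z : ℂ) = ∑ v : Fin p → ι, ∑ w : Fin p → ι,
          exp (-(I * ((∑ k, θ (v k) : ℝ) - (∑ k, θ (w k) : ℝ)))) *
            (if (∑ k, lam (v k) - ∑ k, lam (w k)) = 0 then 1 else 0) := by
        simp only [Z]
        push_cast
        refine Finset.sum_congr rfl fun v _ => Finset.sum_congr rfl fun w _ => ?_
        by_cases h : ∑ k, lam (v k) = ∑ k, lam (w k)
        · have h' := hθ p v w h
          simp only [h, sub_self, if_true]
          have : (∑ k, (θ (v k) : ℂ)) = ∑ k, (θ (w k) : ℂ) := by exact_mod_cast h'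
          simp [this]
        · simp [h, sub_eq_zero]
      rw [this]
      refine HasMean.sum _ (fun v _ => HasMean.sum _ (fun w _ => ?_) fun w _ => by fun_prop)
        fun v _ => by fun_prop
      exact (hasMean_exp _).const_mul _
    have hb := hmean.norm_le (B := (r ^ p) ^ 2) fun t => ?_
    · refine (le_abs_self Z).trans ?_
      rwa [norm_real, Real.norm_eq_abs] at hb
    · have hS : ‖(∑ j, exp (I * (lam j * t - θ j))) ^ p *
          (starRingEnd ℂ) ((∑ j, exp (I * (lam j * t - θ j))) ^ p)‖ ≤ (r ^ p) ^ 2 := by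
        rw [norm_mul, RCLike.norm_conj, ← sq, norm_pow]
        gcongr
        exact hcon t
      convert hS using 2
      rw [expSum_pow, map_sum, Finset.sum_mul_sum]
      refine Finset.sum_congr rfl fun v _ => Finset.sum_congr rfl fun w _ => ?_
      rw [← exp_conj, ← exp_add, ← exp_add]
      congr 1
      simp only [map_mul, conj_I, map_sub, conj_ofReal]
      push_cast
      ring
  have hlim := tendsto_pow_const_mul_const_pow_of_abs_lt_one (Fintype.card ι)
    (r := (r / N) ^ 2) (by
      rw [abs_of_nonneg (by positivity)]
      exact pow_lt_one₀ (by positivity) ((div_lt_one hN0).mpr hr) two_ne_zero)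
  have hlim' := (hlim.comp (tendsto_add_atTop_nat 1))
  by_cases hr1 : r = 0
  · have := key 1
    simp [hr1] at this
    exact hN0.ne' this
  have hq : 0 < (r / N) ^ 2 := by positivity
  have hev := hlim'.eventually (gt_mem_nhds hq)
  obtain ⟨p, hp⟩ := hev.exists
  have h1 := key p
  simp only [Function.comp_apply] at hp
  push_cast at hp
  rw [pow_succ ((r / N) ^ 2) p, ← mul_assoc] at hp
  have h2 : ((p : ℝ) + 1) ^ Fintype.card ι * ((r / N) ^ 2) ^ p < 1 := by
    by_contra! h
    nlinarith
  have h3 : ((r / N) ^ 2) ^ p = (r ^ p) ^ 2 / (N ^ p) ^ 2 := by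
    rw [← pow_mul, mul_comm 2 p, pow_mul, div_pow, div_pow]
  rw [h3, ← mul_div_assoc, div_lt_one (by positivity)] at h2
  linarith

/-- **Kronecker's theorem** on simultaneous approximation. -/
theorem kronecker_approx (lam θ : ι → ℝ)
    (hrel : ∀ k : ι → ℤ, ∑ j, (k j : ℝ) * lam j = 0 → ∑ j, (k j : ℝ) * θ j = 0)
    {ε : ℝ} (hε : 0 < ε) :
    ∃ t : ℝ, ∀ j, ‖exp (I * (lam j * t)) - exp (I * θ j)‖ < ε := by
  classical
  let lam' : Option ι → ℝ := fun o => o.elim 0 lam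
  let θ' : Option ι → ℝ := fun o => o.elim 0 θ
  have hrel' : ∀ k : Option ι → ℤ, ∑ j, (k j : ℝ) * lam' j = 0 → ∑ j, (k j : ℝ) * θ' j = 0 := by
    intro k
    simp only [Fintype.sum_option, lam', θ', Option.elim, mul_zero, zero_add]
    exact hrel fun j => k (some j)
  obtain ⟨ε', hε'0, hε', hε'2⟩ : ∃ ε' : ℝ, 0 < ε' ∧ ε' ≤ ε ∧ ε' ≤ 2 :=
    ⟨min ε 2, by positivity, min_le_left _ _, min_le_right _ _⟩
  have hsq : √(4 - ε' ^ 2) < 2 := by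
    rw [Real.sqrt_lt' two_pos]
    nlinarith
  obtain ⟨t, ht⟩ := exists_lt_norm_expSum lam' θ' hrel'
    (r := (Fintype.card ι : ℝ) - 1 + √(4 - ε' ^ 2)) (by
      simp only [Fintype.card_option]
      push_cast
      linarith)
  refine ⟨t, fun j => ?_⟩
  by_contra! hj
  refine absurd ht (not_lt.mpr ?_)
  set z : ι → ℂ := fun j => exp (I * (lam j * t - θ j)) with hz
  have hz1 : ∀ i, ‖z i‖ = 1 := fun i => by
    simp only [hz]
    rw [norm_exp]
    simp
  have hsum : ∑ o : Option ι, exp (I * (lam' o * t - θ' o)) =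
      (1 + z j) + ∑ i ∈ Finset.univ.erase j, z i := by
    rw [Fintype.sum_option, add_assoc, Finset.add_sum_erase _ _ (Finset.mem_univ j)]
    simp [lam', θ', z]
  have hzj : ε' ≤ ‖1 - z j‖ := by
    refine hε'.trans (hj.trans (le_of_eq ?_))
    have : exp (I * (lam j * t)) - exp (I * θ j) = -(exp (I * θ j) * (1 - z j)) := by
      simp only [hz, mul_sub, exp_sub, mul_one]
      field_simp
      ring
    rw [this, norm_neg, norm_mul, norm_exp]
    simp
  have hpar := parallelogram_law_with_norm ℝ (1 : ℂ) (z j)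
  rw [hz1, norm_one] at hpar
  have h1 : ‖1 + z j‖ ≤ √(4 - ε' ^ 2) := by
    refine Real.le_sqrt_of_sq_le ?_
    nlinarith
  rw [hsum]
  refine (norm_add_le _ _).trans ?_
  have h2 : ‖∑ i ∈ Finset.univ.erase j, z i‖ ≤ (Fintype.card ι : ℝ) - 1 := by
    refine (norm_sum_le _ _).trans ?_
    simp only [hz1, Finset.sum_const, nsmul_eq_mul, mul_one]
    rw [Finset.card_erase_of_mem (Finset.mem_univ j), Finset.card_univ, Nat.cast_sub]
    · simp
    · exact Fintype.card_pos_iff.mpr ⟨j⟩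
  linarith

end Kronecker

/-- The translates of `D` are totally bounded for the supremum norm. -/
def HasTranslationNet (D : ℝ → ℂ) : Prop :=
  ∀ ε : ℝ, 0 < ε → ∃ X : Finset ℝ, ∀ t : ℝ, ∃ x ∈ X, ∀ s : ℝ, ‖D (s + t) - D (s + x)‖ ≤ ε

namespace HasTranslationNet

variable {D : ℝ → ℂ}

lemma exists_bound (hD : HasTranslationNet D) : ∃ B : ℝ, 0 ≤ B ∧ ∀ t, ‖D t‖ ≤ B := by
  obtain ⟨X, hX⟩ := hD 1 one_pos
  refine ⟨1 + ∑ x ∈ X, ‖D x‖, by positivity, fun t => ?_⟩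
  obtain ⟨x, hx, h⟩ := hX t
  have h0 := h 0
  rw [zero_add, zero_add] at h0
  have h1 := Finset.single_le_sum (f := fun x => ‖D x‖) (fun _ _ => norm_nonneg _) hx
  have h2 := norm_sub_norm_le (D t) (D x)
  linarith

lemma exists_modulus (hD : HasTranslationNet D) (hc : Continuous D) {ε : ℝ} (hε : 0 < ε) :
    ∃ δ > 0, ∀ u, |u| ≤ δ → ∀ s, ‖D (s + u) - D s‖ ≤ ε := by
  obtain ⟨X, hX⟩ := hD (ε / 3) (by positivity)
  have h1 : ∀ᶠ u in 𝓝 (0 : ℝ), ∀ x ∈ X, ‖D (u + x) - D x‖ < ε / 3 := by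
    rw [Finset.eventually_all]
    intro x _
    have : Tendsto (fun u => ‖D (u + x) - D x‖) (𝓝 0) (𝓝 ‖D (0 + x) - D x‖) :=
      Continuous.tendsto (by fun_prop) 0
    rw [zero_add, sub_self, norm_zero] at this
    exact this.eventually (gt_mem_nhds (by positivity))
  obtain ⟨δ, hδ, h⟩ := Metric.eventually_nhds_iff.mp h1
  refine ⟨δ / 2, by positivity, fun u hu s => ?_⟩
  obtain ⟨x, hx, hs⟩ := hX s
  have h2 := h (y := u) (by rw [Real.dist_eq, sub_zero]; linarith) x hx
  have h3 := hs u
  have h4 := hs 0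
  rw [zero_add, zero_add, norm_sub_rev] at h4
  have e : D (s + u) - D s = (D (u + s) - D (u + x)) + (D (u + x) - D x) + (D x - D s) := by
    rw [add_comm s u]; ring
  rw [e]
  refine (norm_add₃_le).trans ?_
  linarith

lemma translate (hD : HasTranslationNet D) (y : ℝ) : HasTranslationNet fun s => D (s + y) := by
  intro ε hε
  obtain ⟨X, hX⟩ := hD ε hε
  refine ⟨X, fun t => ?_⟩
  obtain ⟨x, hx, h⟩ := hX t
  refine ⟨x, hx, fun s => ?_⟩
  convert h (s + y) using 4 <;> ring

lemma sub {E : ℝ → ℂ} (hD : HasTranslationNet D) (hE : HasTranslationNet E) :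
    HasTranslationNet fun s => D s - E s := by
  classical
  intro ε hε
  obtain ⟨X, hX⟩ := hD (ε / 4) (by positivity)
  obtain ⟨Y, hY⟩ := hE (ε / 4) (by positivity)
  choose x hxX hx using hX
  choose y hyY hy using hY
  have hfin : (Set.range fun t => (x t, y t)).Finite :=
    (X ×ˢ Y).finite_toSet.subset (by
      rintro _ ⟨t, rfl⟩
      simp [hxX, hyY])
  choose! r hr using fun p (hp : p ∈ Set.range fun t => (x t, y t)) => hp
  refine ⟨hfin.toFinset.image r, fun t => ⟨r (x t, y t), ?_, fun s => ?_⟩⟩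
  · refine Finset.mem_image_of_mem _ ?_
    simpa using ⟨t, rfl, rfl⟩
  · have hp := hr (x t, y t) ⟨t, rfl⟩
    simp only [Prod.mk.injEq] at hp
    set t' := r (x t, y t)
    have h1 := hx t s
    have h2 := hx t' s
    have h3 := hy t s
    have h4 := hy t' s
    rw [hp.1, norm_sub_rev] at h2
    rw [hp.2] at h4
    rw [norm_sub_rev] at h3
    have e : D (s + t) - E (s + t) - (D (s + t') - E (s + t')) =
      ((D (s + t) - D (s + x t)) + (D (s + x t) - D (s + t'))) +
        ((E (s + y t) - E (s + t)) + (E (s + t') - E (s + y t))) := by ring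
    rw [e]
    refine (norm_add_le _ _).trans ?_
    have h5 := norm_add_le (D (s + t) - D (s + x t)) (D (s + x t) - D (s + t'))
    have h6 := norm_add_le (E (s + y t) - E (s + t)) (E (s + t') - E (s + y t))
    linarith

end HasTranslationNet

/-- Orthogonality of the characters of the circle. -/
lemma integral_exp_int (k : ℤ) :
    ∫ θ in (-Real.pi)..Real.pi, exp (I * k * θ) = if k = 0 then (2 * Real.pi : ℂ) else 0 := by
  split_ifs with h
  · simp [h]
    ring
  · have hc : I * (k : ℂ) ≠ 0 := mul_ne_zero I_ne_zero (by exact_mod_cast h)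
    rw [integral_exp_mul_complex hc]
    have : exp (I * k * (Real.pi : ℝ)) = exp (I * k * ((-Real.pi : ℝ) : ℂ)) := by
      rw [exp_eq_exp_iff_exists_int]
      refine ⟨k, ?_⟩
      push_cast
      ring
    rw [this, sub_self, zero_div]

/-- A bilinear estimate: the sum of `d` over a sumset `P + P`, counted with multiplicity, is
controlled by the supremum of the trigonometric polynomial with coefficients `d`. -/
lemma norm_sum_sum_add_le (d : ℕ → ℂ) (N : ℕ) (P : Finset ℕ) (hP : ∀ n ∈ P, ∀ m ∈ P, n + m < N)
    {B : ℝ} (hB : ∀ θ : ℝ, |θ| ≤ Real.pi →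
      ‖∑ l ∈ Finset.range N, d l * exp (-(I * θ * l))‖ ≤ B) :
    ‖∑ n ∈ P, ∑ m ∈ P, d (n + m)‖ ≤ B * P.card := by
  have hpi := Real.pi_pos
  set G : ℝ → ℂ := fun θ => ∑ l ∈ Finset.range N, d l * exp (-(I * θ * l)) with hG
  set V : ℝ → ℂ := fun θ => ∑ n ∈ P, exp (I * n * θ) with hV
  have cG : Continuous G := by fun_prop
  have cV : Continuous V := by fun_prop
  have h1 : ∫ θ in (-Real.pi)..Real.pi, G θ * (V θ * V θ) =
      2 * Real.pi * ∑ n ∈ P, ∑ m ∈ P, d (n + m) := by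
    have e : ∀ θ : ℝ, G θ * (V θ * V θ) = ∑ n ∈ P, ∑ m ∈ P, ∑ l ∈ Finset.range N,
        d l * exp (I * (((n : ℤ) + m - l : ℤ) : ℂ) * θ) := by
      intro θ
      simp only [hG, hV]
      rw [mul_comm, Finset.sum_mul_sum, Finset.sum_mul]
      refine Finset.sum_congr rfl fun n _ => ?_
      rw [Finset.sum_mul]
      refine Finset.sum_congr rfl fun m _ => ?_
      rw [Finset.mul_sum]
      refine Finset.sum_congr rfl fun l _ => ?_
      rw [mul_left_comm, ← exp_add, ← exp_add]
      congr 2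
      push_cast
      ring
    simp_rw [e]
    rw [intervalIntegral.integral_finsetSum fun n _ => Continuous.intervalIntegrable (by fun_prop) _ _,
      Finset.mul_sum]
    refine Finset.sum_congr rfl fun n hn => ?_
    rw [intervalIntegral.integral_finsetSum fun n _ => Continuous.intervalIntegrable (by fun_prop) _ _,
      Finset.mul_sum]
    refine Finset.sum_congr rfl fun m hm => ?_
    rw [intervalIntegral.integral_finsetSum fun n _ => Continuous.intervalIntegrable (by fun_prop) _ _,
      Finset.sum_eq_single (n + m)]
    · rw [intervalIntegral.integral_const_mul, integral_exp_int, if_pos (by push_cast; ring)]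
      ring
    · intro l _ hl
      rw [intervalIntegral.integral_const_mul, integral_exp_int, if_neg, mul_zero]
      intro h
      apply hl
      omega
    · intro h
      exact absurd (Finset.mem_range.mpr (hP n hn m hm)) h
  have h2 : ∫ θ in (-Real.pi)..Real.pi, ‖V θ‖ ^ 2 = 2 * Real.pi * P.card := by
    have e : ∀ θ : ℝ, ((‖V θ‖ ^ 2 : ℝ) : ℂ) =
        ∑ n ∈ P, ∑ m ∈ P, exp (I * (((n : ℤ) - m : ℤ) : ℂ) * θ) := by
      intro θ
      push_cast
      rw [← Complex.mul_conj', hV]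
      simp only
      rw [map_sum, Finset.sum_mul_sum]
      refine Finset.sum_congr rfl fun n _ => Finset.sum_congr rfl fun m _ => ?_
      rw [← exp_conj, ← exp_add]
      congr 1
      simp
      ring
    have : ((∫ θ in (-Real.pi)..Real.pi, ‖V θ‖ ^ 2 : ℝ) : ℂ) = (2 * Real.pi * P.card : ℝ) := by
      rw [← intervalIntegral.integral_ofReal]
      simp_rw [e]
      rw [intervalIntegral.integral_finsetSum fun n _ =>
        Continuous.intervalIntegrable (by fun_prop) _ _]
      have : ∀ n ∈ P, ∫ θ in (-Real.pi)..Real.pi,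
          ∑ m ∈ P, exp (I * (((n : ℤ) - m : ℤ) : ℂ) * θ) = 2 * Real.pi := by
        intro n hn
        rw [intervalIntegral.integral_finsetSum fun n _ =>
          Continuous.intervalIntegrable (by fun_prop) _ _, Finset.sum_eq_single n]
        · rw [integral_exp_int, if_pos (sub_self _)]
        · intro m _ hm
          rw [integral_exp_int, if_neg]
          intro h
          apply hm
          omega
        · exact fun h => absurd hn h
      rw [Finset.sum_congr rfl this]
      simp
      ring
    exact_mod_cast this
  have h3 : ‖∫ θ in (-Real.pi)..Real.pi, G θ * (V θ * V θ)‖ ≤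
      ∫ θ in (-Real.pi)..Real.pi, B * ‖V θ‖ ^ 2 := by
    refine intervalIntegral.norm_integral_le_of_norm_le (by linarith) ?_
      (Continuous.intervalIntegrable (by fun_prop) _ _)
    refine MeasureTheory.ae_of_all _ fun θ hθ => ?_
    rw [norm_mul, norm_mul, ← sq]
    gcongr
    exact hB θ (abs_le.mpr ⟨hθ.1.le, hθ.2⟩)
  rw [h1, intervalIntegral.integral_const_mul, h2, norm_mul] at h3
  have h4 : ‖(2 * Real.pi : ℂ)‖ = 2 * Real.pi := by
    simp [abs_of_pos hpi]
  rw [h4] at h3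
  nlinarith

/-- Lower bound for the Fourier transform of an interval at low frequencies. -/
lemma le_norm_integral_exp {h x : ℝ} (hh : 0 < h) (hx : |x * h| ≤ Real.pi) :
    2 / Real.pi * h ≤ ‖∫ u in (0 : ℝ)..h, exp (-(I * x * u))‖ := by
  have hpi := Real.pi_pos
  rcases eq_or_ne x 0 with rfl | h0
  · simp only [ofReal_zero, mul_zero, zero_mul, neg_zero, exp_zero]
    simp only [intervalIntegral.integral_const, sub_zero, real_smul, mul_one, norm_real,
      Real.norm_eq_abs, abs_of_pos hh]
    have : 2 / Real.pi ≤ 1 := by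
      rw [div_le_one hpi]
      exact Real.two_le_pi
    nlinarith
  · have hc : -(I * (x : ℂ)) ≠ 0 := neg_ne_zero.mpr (mul_ne_zero I_ne_zero (by exact_mod_cast h0))
    have e : ∀ u : ℝ, exp (-(I * x * u)) = exp (-(I * x) * u) := fun u => by rw [neg_mul]
    simp_rw [e]
    rw [integral_exp_mul_complex hc, norm_div]
    have h1 : ‖-(I * (x : ℂ))‖ = |x| := by simp
    have h2 : exp (-(I * x) * (h : ℝ)) - exp (-(I * x) * ((0 : ℝ) : ℂ)) =
        exp (I * ((-(x * h) : ℝ) : ℂ)) - 1 := by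
      simp
      ring_nf
    have hxp : 0 < |x| := abs_pos.mpr h0
    rw [h1, h2, norm_exp_I_mul_ofReal_sub_one, le_div_iff₀ hxp, norm_mul, neg_div, Real.sin_neg,
      norm_neg, Real.norm_eq_abs, Real.norm_eq_abs, abs_two]
    have h3 := Real.mul_abs_le_abs_sin (x := x * h / 2) (by
      rw [abs_div, abs_two]
      linarith)
    rw [abs_div, abs_two, abs_mul, abs_of_pos hh] at h3
    calc _ = 2 * (2 / Real.pi * (|x| * h / 2)) := by ring
      _ ≤ _ := by gcongr

/-- Comparison of a sampled exponential sum with the corresponding integral. -/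
lemma norm_sum_sample_le {D : ℝ → ℂ} (hc : Continuous D) {h ω x : ℝ} (hh : 0 < h)
    (hω : ∀ u, |u| ≤ h → ∀ s, ‖D (s + u) - D s‖ ≤ ω) (hx : |x * h| ≤ Real.pi) (N : ℕ) :
    ‖∑ n ∈ Finset.range N, D (n * h) * exp (-(I * x * (n * h : ℝ)))‖ * (2 / Real.pi * h) ≤
      N * (h * ω) + ‖∫ t in (0 : ℝ)..(N * h : ℝ), D t * exp (-(I * x * t))‖ := by
  set κ : ℂ := ∫ u in (0 : ℝ)..h, exp (-(I * x * u)) with hκ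
  set S : ℂ := ∑ n ∈ Finset.range N, D (n * h) * exp (-(I * x * (n * h : ℝ))) with hS
  set J : ℂ := ∫ t in (0 : ℝ)..(N * h : ℝ), D t * exp (-(I * x * t)) with hJ
  have hJ' : J = ∑ n ∈ Finset.range N,
      ∫ u in (0 : ℝ)..h, D (n * h + u) * exp (-(I * x * (n * h + u : ℝ))) := by
    have := intervalIntegral.sum_integral_adjacent_intervals (μ := MeasureTheory.volume)
      (f := fun t : ℝ => D t * exp (-(I * x * t))) (a := fun n : ℕ => (n : ℝ) * h) (n := N)
      fun k _ => Continuous.intervalIntegrable (by fun_prop) _ _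
    simp only [Nat.cast_zero, zero_mul] at this
    rw [hJ, ← this]
    refine Finset.sum_congr rfl fun n _ => ?_
    have := intervalIntegral.integral_comp_add_left (a := 0) (b := h)
      (fun t : ℝ => D t * exp (-(I * x * t))) (n * h)
    rw [this]
    congr 1 <;> push_cast <;> ring
  have hSκ : S * κ = ∑ n ∈ Finset.range N,
      ∫ u in (0 : ℝ)..h, D (n * h) * exp (-(I * x * (n * h + u : ℝ))) := by
    rw [hS, Finset.sum_mul]
    refine Finset.sum_congr rfl fun n _ => ?_
    rw [hκ, ← intervalIntegral.integral_const_mul]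
    refine intervalIntegral.integral_congr fun u _ => ?_
    rw [mul_assoc, ← exp_add]
    congr 2
    push_cast
    ring
  have hdiff : ‖S * κ - J‖ ≤ N * (h * ω) := by
    rw [hSκ, hJ', ← Finset.sum_sub_distrib]
    refine (norm_sum_le _ _).trans ?_
    rw [← nsmul_eq_mul, ← Finset.card_range N, ← Finset.sum_const, Finset.card_range]
    refine Finset.sum_le_sum fun n _ => ?_
    rw [← intervalIntegral.integral_sub (Continuous.intervalIntegrable (by fun_prop) _ _)
      (Continuous.intervalIntegrable (by fun_prop) _ _)]
    have := intervalIntegral.norm_integral_le_of_norm_le_const (a := 0) (b := h) (C := ω)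
      (f := fun u : ℝ => D (n * h) * exp (-(I * x * (n * h + u : ℝ))) -
        D (n * h + u) * exp (-(I * x * (n * h + u : ℝ)))) fun u hu => by
      rw [Set.uIoc_of_le hh.le] at hu
      rw [← sub_mul, norm_mul, norm_sub_rev, norm_exp]
      have : (-(I * (x : ℂ) * ((n * h + u : ℝ) : ℂ))).re = 0 := by simp
      rw [this, Real.exp_zero, mul_one]
      exact hω u (by rw [abs_of_pos hu.1]; exact hu.2) _
    rwa [sub_zero, abs_of_pos hh, mul_comm ω h] at this
  calc ‖S‖ * (2 / Real.pi * h) ≤ ‖S‖ * ‖κ‖ := by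
        gcongr
        exact le_norm_integral_exp hh hx
    _ = ‖S * κ‖ := (norm_mul _ _).symm
    _ ≤ ‖S * κ - J‖ + ‖J‖ := by
        have := norm_add_le (S * κ - J) J
        rwa [sub_add_cancel] at this
    _ ≤ _ := by gcongr

/-- The mean value of a bounded function does not see translations. -/
lemma HasMean.translate {g : ℝ → ℂ} {c : ℂ} {B : ℝ} (hg : HasMean g c) (cg : Continuous g)
    (hB : ∀ t, ‖g t‖ ≤ B) (y : ℝ) : HasMean (fun t => g (t + y)) c := by
  have h0 : Tendsto (fun T : ℝ => (1 / (2 * (T : ℂ))) *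
      ((∫ t in T..(T + y), g t) - ∫ t in (-T)..(-T + y), g t)) atTop (𝓝 0) := by
    refine squeeze_zero_norm' (a := fun T : ℝ => (B * |y|) * T⁻¹) ?_ ?_
    · filter_upwards [eventually_gt_atTop 0] with T hT
      have h3 : ‖1 / (2 * (T : ℂ))‖ = 1 / (2 * T) := by simp [abs_of_pos hT]
      have h4 : ∀ a : ℝ, ‖∫ t in a..(a + y), g t‖ ≤ B * |y| := fun a => by
        have := intervalIntegral.norm_integral_le_of_norm_le_const (a := a) (b := a + y) (f := g)
          (C := B) fun t _ => hB t
        rwa [add_sub_cancel_left] at this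
      rw [norm_mul, h3]
      calc _ ≤ 1 / (2 * T) * (B * |y| + B * |y|) := by
            gcongr
            exact (norm_sub_le _ _).trans (add_le_add (h4 _) (h4 _))
        _ = _ := by field_simp; ring
    · simpa using tendsto_inv_atTop_zero.const_mul (B * |y|)
  have h1 := Tendsto.add hg h0
  rw [add_zero] at h1
  refine h1.congr fun T => ?_
  rw [intervalIntegral.integral_comp_add_right, ← mul_add]
  congr 1
  have i : ∀ a b : ℝ, IntervalIntegrable g MeasureTheory.volume a b :=
    fun a b => cg.intervalIntegrable a b
  have e1 := intervalIntegral.integral_add_adjacent_intervals (i (-T) (-T + y)) (i (-T + y) (T + y))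
  have e2 := intervalIntegral.integral_add_adjacent_intervals (i (-T) T) (i T (T + y))
  rw [← e2] at e1
  linear_combination -e1

lemma HasMean.translate_fourier {D : ℝ → ℂ} {x : ℝ} {c : ℂ} {B : ℝ}
    (hg : HasMean (fun t => D t * exp (-(I * x * t))) c) (cD : Continuous D)
    (hB : ∀ t, ‖D t‖ ≤ B) (y : ℝ) :
    HasMean (fun t => D (t + y) * exp (-(I * x * t))) (exp (I * x * y) * c) := by
  have h1 := hg.translate (B := B) (by fun_prop) (fun t => by
    rw [norm_mul, norm_exp]
    have : (-(I * (x : ℂ) * t)).re = 0 := by simp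
    rw [this, Real.exp_zero, mul_one]
    exact hB t) y
  refine (h1.const_mul (exp (I * x * y))).congr fun T => ?_
  congr 1
  refine intervalIntegral.integral_congr fun t _ => ?_
  rw [mul_left_comm, ← exp_add]
  congr 2
  push_cast
  ring

/-- The windowed Fourier integral of `D` at frequency `x`, on the window of radius `T` around
`t₀`. -/
def windowIntegral (D : ℝ → ℂ) (T x t₀ : ℝ) : ℂ :=
  ∫ s in (-T)..T, D (s + t₀) * exp (-(I * x * s))

section Window

variable {D : ℝ → ℂ}

lemma norm_exp_neg_I_mul (x s : ℝ) : ‖exp (-(I * x * s))‖ = 1 := by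
  rw [norm_exp]
  simp

lemma norm_windowIntegral_two_mul_le (hc : Continuous D) {T x C : ℝ}
    (h : ∀ t₀, ‖windowIntegral D T x t₀‖ ≤ C) (t₀ : ℝ) :
    ‖windowIntegral D (2 * T) x t₀‖ ≤ 2 * C := by
  have i : ∀ a b : ℝ, IntervalIntegrable (fun s => D (s + t₀) * exp (-(I * x * s)))
    MeasureTheory.volume a b := fun a b => Continuous.intervalIntegrable (by fun_prop) a b
  have e : ∀ a : ℝ, ∫ s in (-T + a)..(T + a), D (s + t₀) * exp (-(I * x * s)) =
      exp (-(I * x * a)) * windowIntegral D T x (t₀ + a) := by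
    intro a
    rw [windowIntegral, ← intervalIntegral.integral_const_mul,
      ← intervalIntegral.integral_comp_add_right]
    refine intervalIntegral.integral_congr fun s _ => ?_
    rw [mul_left_comm, ← exp_add, add_assoc, add_comm a]
    congr 2
    push_cast
    ring
  have e1 := e (-T)
  have e2 := e T
  rw [show -T + -T = -(2 * T) by ring, show T + -T = 0 by ring] at e1
  rw [show -T + T = 0 by ring, show T + T = 2 * T by ring] at e2
  rw [windowIntegral, ← intervalIntegral.integral_add_adjacent_intervals (i _ 0) (i 0 _), e1, e2,
    two_mul]
  refine (norm_add_le _ _).trans (add_le_add ?_ ?_) <;>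
  · rw [norm_mul, norm_exp_neg_I_mul, one_mul]
    exact h _

lemma norm_windowIntegral_sub_le (hc : Continuous D) {B T : ℝ} (hT : 0 ≤ T) (hB : ∀ t, ‖D t‖ ≤ B)
    (x y t₀ : ℝ) :
    ‖windowIntegral D T x t₀ - windowIntegral D T y t₀‖ ≤ B * (|x - y| * T) * (2 * T) := by
  have hB0 : 0 ≤ B := (norm_nonneg _).trans (hB 0)
  rw [windowIntegral, windowIntegral,
    ← intervalIntegral.integral_sub (Continuous.intervalIntegrable (by fun_prop) _ _)
      (Continuous.intervalIntegrable (by fun_prop) _ _)]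
  have := intervalIntegral.norm_integral_le_of_norm_le_const (a := -T) (b := T)
    (C := B * (|x - y| * T))
    (f := fun s => D (s + t₀) * exp (-(I * x * s)) - D (s + t₀) * exp (-(I * y * s))) fun s hs => by
      rw [Set.uIoc_of_le (by linarith)] at hs
      rw [← mul_sub, norm_mul]
      gcongr
      · exact hB _
      · have e : exp (-(I * x * s)) - exp (-(I * y * s)) =
            exp (-(I * y * s)) * (exp (I * ((-((x - y) * s) : ℝ) : ℂ)) - 1) := by
          rw [mul_sub, ← exp_add, mul_one]
          congr 2
          push_cast
          ring
        rw [e, norm_mul, norm_exp_neg_I_mul, one_mul]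
        refine (Real.norm_exp_I_mul_ofReal_sub_one_le).trans ?_
        rw [norm_neg, norm_mul, Real.norm_eq_abs, Real.norm_eq_abs]
        gcongr
        exact abs_le.mpr ⟨hs.1.le, hs.2⟩
  refine this.trans (le_of_eq ?_)
  rw [abs_of_nonneg (show (0 : ℝ) ≤ T - -T by linarith)]
  ring

/-- If a Fourier coefficient vanishes, the windowed means tend to zero uniformly in the window. -/
lemma HasTranslationNet.eventually_windowIntegral_le (hD : HasTranslationNet D) (hc : Continuous D)
    {x : ℝ} (hx : HasMean (fun t => D t * exp (-(I * x * t))) 0) {ε : ℝ} (hε : 0 < ε) :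
    ∀ᶠ T in atTop, ∀ t₀, ‖windowIntegral D T x t₀‖ ≤ ε * (2 * T) := by
  obtain ⟨B, -, hB⟩ := hD.exists_bound
  obtain ⟨X, hX⟩ := hD (ε / 2) (by positivity)
  have h1 : ∀ᶠ T in atTop, ∀ y ∈ X, ‖windowIntegral D T x y‖ ≤ ε / 2 * (2 * T) := by
    rw [Finset.eventually_all]
    intro y _
    have h2 := (hx.translate_fourier hc hB y)
    rw [mul_zero] at h2
    filter_upwards [(tendsto_zero_iff_norm_tendsto_zero.mp h2).eventually
      (gt_mem_nhds (half_pos hε)), eventually_gt_atTop 0] with T hT hT0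
    have h3 : ‖1 / (2 * (T : ℂ))‖ = 1 / (2 * T) := by simp [abs_of_pos hT0]
    rw [norm_mul, h3, one_div_mul_eq_div, div_lt_iff₀ (by positivity)] at hT
    exact hT.le
  filter_upwards [h1, eventually_gt_atTop 0] with T hT hT0 t₀
  obtain ⟨y, hy, hys⟩ := hX t₀
  have h4 : ‖windowIntegral D T x t₀ - windowIntegral D T x y‖ ≤ ε / 2 * (2 * T) := by
    rw [windowIntegral, windowIntegral,
      ← intervalIntegral.integral_sub (Continuous.intervalIntegrable (by fun_prop) _ _)
        (Continuous.intervalIntegrable (by fun_prop) _ _)]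
    have := intervalIntegral.norm_integral_le_of_norm_le_const (a := -T) (b := T) (C := ε / 2)
      (f := fun s => D (s + t₀) * exp (-(I * x * s)) - D (s + y) * exp (-(I * x * s)))
      fun s _ => by
        rw [← sub_mul, norm_mul, norm_exp_neg_I_mul, mul_one]
        exact hys s
    refine this.trans (le_of_eq ?_)
    rw [abs_of_nonneg (by linarith)]
    ring
  have h5 := norm_add_le (windowIntegral D T x t₀ - windowIntegral D T x y) (windowIntegral D T x y)
  rw [sub_add_cancel] at h5
  linarith [hT y hy]

/-- Uniformity over compact sets of frequencies, along dyadic window lengths. -/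
lemma HasTranslationNet.exists_windowIntegral_le (hD : HasTranslationNet D) (hc : Continuous D)
    (hx : ∀ x : ℝ, HasMean (fun t => D t * exp (-(I * x * t))) 0) {ε : ℝ} (hε : 0 < ε)
    {s : Set ℝ} (hs : IsCompact s) :
    ∃ K : ℕ, ∀ k ≥ K, ∀ x ∈ s, ∀ t₀, ‖windowIntegral D (2 ^ k) x t₀‖ ≤ ε * (2 * 2 ^ k) := by
  obtain ⟨B, hB0, hB⟩ := hD.exists_bound
  refine hs.induction_on ?_ ?_ ?_ ?_
  · exact ⟨0, by simp⟩
  · intro s t h ht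
    obtain ⟨K, hK⟩ := ht
    exact ⟨K, fun k hk x hx => hK k hk x (h hx)⟩
  · intro s t h₁ h₂
    obtain ⟨K₁, h₁⟩ := h₁
    obtain ⟨K₂, h₂⟩ := h₂
    refine ⟨max K₁ K₂, fun k hk x hx => hx.elim (h₁ k ?_ x) (h₂ k ?_ x)⟩
    · exact (le_max_left _ _).trans hk
    · exact (le_max_right _ _).trans hk
  · intro x _
    have h1 := hD.eventually_windowIntegral_le hc (hx x) (half_pos hε)
    obtain ⟨K, hK⟩ := ((tendsto_pow_atTop_atTop_of_one_lt (one_lt_two (α := ℝ))).eventually h1).exists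
    refine ⟨Metric.closedBall x (ε / 2 / ((B + 1) * 2 ^ K)),
      mem_nhdsWithin_of_mem_nhds (Metric.closedBall_mem_nhds _ (by positivity)), K, ?_⟩
    intro k hk
    induction k, hk using Nat.le_induction with
    | base =>
      intro y hy t₀
      have h2 := norm_windowIntegral_sub_le hc (T := 2 ^ K) (by positivity) hB y x t₀
      rw [Metric.mem_closedBall, Real.dist_eq, le_div_iff₀ (by positivity)] at hy
      have h3 : B * (|y - x| * 2 ^ K) ≤ ε / 2 := by
        refine le_trans ?_ hy
        have : 0 ≤ |y - x| * 2 ^ K := by positivity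
        nlinarith
      have h4 := norm_add_le (windowIntegral D (2 ^ K) y t₀ - windowIntegral D (2 ^ K) x t₀)
        (windowIntegral D (2 ^ K) x t₀)
      rw [sub_add_cancel] at h4
      have h5 := mul_le_mul_of_nonneg_right h3 (show (0 : ℝ) ≤ 2 * 2 ^ K by positivity)
      linarith [hK t₀]
    | succ k _ ih =>
      intro y hy t₀
      have := norm_windowIntegral_two_mul_le hc (ih y hy) t₀
      rw [pow_succ']
      linarith

/-- Pigeonhole: a positive proportion of the multiples of `h` are almost periods. -/
lemma exists_finset_almost_periods {X : Finset ℝ} {ε : ℝ}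
    (hX : ∀ t : ℝ, ∃ x ∈ X, ∀ s : ℝ, ‖D (s + t) - D (s + x)‖ ≤ ε) (h : ℝ) {K : ℕ} (hK : 0 < K) :
    ∃ P : Finset ℕ, (∀ p ∈ P, p < K) ∧ (K : ℝ) ≤ X.card * P.card ∧
      ∀ p ∈ P, ∀ s : ℝ, ‖D (s + p * h) - D s‖ ≤ 2 * ε := by
  classical
  choose x hxX hx using hX
  have hXne : X.Nonempty := ⟨_, hxX 0⟩
  have hXc : (0 : ℝ) < X.card := by exact_mod_cast hXne.card_pos
  obtain ⟨y, -, hy⟩ := Finset.exists_le_card_fiber_of_nsmul_le_card_of_maps_to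
    (s := Finset.range K) (t := X) (f := fun n : ℕ => x (n * h)) (b := (K : ℝ) / X.card)
    (fun n _ => hxX _) hXne (by
      rw [nsmul_eq_mul, mul_div_cancel₀ _ hXc.ne', Finset.card_range])
  set A := (Finset.range K).filter fun n : ℕ => x (n * h) = y with hA
  have hAne : A.Nonempty := by
    rw [← Finset.card_pos]
    have : (0 : ℝ) < K / X.card := by positivity
    exact_mod_cast this.trans_le hy
  set n₀ := A.min' hAne with hn₀
  have hle : ∀ n ∈ A, n₀ ≤ n := fun n hn => A.min'_le n hn
  refine ⟨A.image fun n => n - n₀, ?_, ?_, ?_⟩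
  · intro p hp
    obtain ⟨n, hn, rfl⟩ := Finset.mem_image.mp hp
    have := Finset.mem_range.mp (Finset.mem_filter.mp hn).1
    omega
  · rw [Finset.card_image_of_injOn]
    · rwa [div_le_iff₀' hXc] at hy
    · intro a ha b hb hab
      have h1 := hle a ha
      have h2 := hle b hb
      simp only at hab
      omega
  · intro p hp s
    obtain ⟨n, hn, rfl⟩ := Finset.mem_image.mp hp
    have h1 := hx (n * h) (s - n₀ * h)
    have h2 := hx (n₀ * h) (s - n₀ * h)
    rw [(Finset.mem_filter.mp hn).2] at h1
    rw [(Finset.mem_filter.mp (A.min'_mem hAne)).2, norm_sub_rev, sub_add_cancel] at h2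
    have e : s - n₀ * h + n * h = s + ((n - n₀ : ℕ) : ℝ) * h := by
      rw [Nat.cast_sub (hle n hn)]
      ring
    rw [e] at h1
    have h3 := norm_add_le (D (s + ((n - n₀ : ℕ) : ℝ) * h) - D (s - n₀ * h + y))
      (D (s - n₀ * h + y) - D s)
    rw [sub_add_sub_cancel] at h3
    linarith

lemma HasTranslationNet.apply_zero_eq_zero (hD : HasTranslationNet D) (hc : Continuous D)
    (hx : ∀ x : ℝ, HasMean (fun t => D t * exp (-(I * x * t))) 0) : D 0 = 0 := by
  by_contra hne
  have hpi := Real.pi_pos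
  obtain ⟨ε, hε, hε8⟩ : ∃ ε : ℝ, 0 < ε ∧ ‖D 0‖ = 8 * ε :=
    ⟨‖D 0‖ / 8, by positivity, by ring⟩
  obtain ⟨X, hX⟩ := hD ε hε
  have hXc : (0 : ℝ) < X.card := by
    obtain ⟨x, hxX, -⟩ := hX 0
    exact_mod_cast Finset.card_pos.mpr ⟨x, hxX⟩
  set ω : ℝ := ε / (2 * X.card) with hω
  have hω0 : 0 < ω := by positivity
  obtain ⟨δ, hδ, hmod⟩ := hD.exists_modulus hc hω0
  obtain ⟨r, hr⟩ := exists_pow_lt_of_lt_one hδ (show (1 / 2 : ℝ) < 1 by norm_num)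
  set h : ℝ := (1 / 2) ^ r with hh
  have hh0 : 0 < h := by positivity
  obtain ⟨k, hk⟩ := hD.exists_windowIntegral_le hc hx hω0
    (isCompact_Icc (a := -(Real.pi / h)) (b := Real.pi / h))
  set K : ℕ := 2 ^ (k + r) with hK
  have hKh : (K : ℝ) * h = 2 ^ k := by
    rw [hK, hh, pow_add]
    push_cast
    rw [mul_assoc, ← mul_pow]
    norm_num
  obtain ⟨P, hPK, hPc, hPa⟩ := exists_finset_almost_periods hX h (K := K) (by positivity)
  have hupper := norm_sum_sum_add_le (fun n => D (n * h)) (2 * K) P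
    (fun n hn m hm => by linarith [hPK n hn, hPK m hm])
    (B := Real.pi / 2 * ((2 * K : ℕ) * (ω + ω))) (fun θ hθ => by
      have h1 := norm_sum_sample_le hc hh0 (x := θ / h) (fun u hu => hmod u (hu.trans hr.le))
        (by rwa [div_mul_cancel₀ _ hh0.ne']) (2 * K)
      have e : ∀ n : ℕ, -(I * ((θ / h : ℝ) : ℂ) * ((n * h : ℝ) : ℂ)) = -(I * θ * n) := by
        intro n
        have : (h : ℂ) ≠ 0 := by exact_mod_cast hh0.ne'
        push_cast
        field_simp
      simp_rw [e] at h1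
      have h2 : ‖∫ t in (0 : ℝ)..((2 * K : ℕ) * h : ℝ), D t * exp (-(I * (θ / h : ℝ) * t))‖ ≤
          ω * (2 * 2 ^ k) := by
        have h3 := hk k le_rfl (θ / h) (by
          rw [Set.mem_Icc, ← abs_le, abs_div, abs_of_pos hh0]
          gcongr) (2 ^ k)
        refine le_trans (le_of_eq ?_) h3
        have h4 := intervalIntegral.integral_comp_add_right (a := -(2 : ℝ) ^ k) (b := 2 ^ k)
          (fun t : ℝ => D t * exp (-(I * (θ / h : ℝ) * t))) (2 ^ k)
        rw [neg_add_cancel] at h4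
        have h5 : (((2 * K : ℕ) : ℝ) * h) = 2 ^ k + 2 ^ k := by
          push_cast
          rw [mul_assoc, hKh]
          ring
        rw [h5, ← h4]
        have h6 : ∀ s : ℝ, D (s + 2 ^ k) * exp (-(I * (θ / h : ℝ) * ((s + 2 ^ k : ℝ) : ℂ))) =
            exp (-(I * (θ / h : ℝ) * ((2 ^ k : ℝ) : ℂ))) *
              (D (s + 2 ^ k) * exp (-(I * (θ / h : ℝ) * s))) := by
          intro s
          rw [mul_left_comm, ← exp_add]
          congr 2
          push_cast
          ring
        simp_rw [h6]
        rw [intervalIntegral.integral_const_mul, norm_mul, norm_exp_neg_I_mul, one_mul,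
          windowIntegral]
      have h3 : ω * (2 * 2 ^ k) = (2 * K : ℕ) * (h * ω) := by
        push_cast
        rw [← hKh]
        ring
      rw [h3] at h2
      set S := ‖∑ l ∈ Finset.range (2 * K), D (l * h) * exp (-(I * θ * l))‖
      have h4 : S * (2 / Real.pi * h) ≤ (2 * K : ℕ) * (ω + ω) * h := by linarith
      have h5 : S * (2 / Real.pi) ≤ (2 * K : ℕ) * (ω + ω) :=
        le_of_mul_le_mul_right (by rwa [mul_assoc]) hh0
      calc S = Real.pi / 2 * (S * (2 / Real.pi)) := by field_simp
        _ ≤ _ := by gcongr)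
  have hlower : (P.card : ℝ) * P.card * (4 * ε) ≤
      ‖∑ n ∈ P, ∑ m ∈ P, D (((n + m : ℕ) : ℝ) * h)‖ := by
    have h1 : ‖∑ n ∈ P, ∑ m ∈ P, (D 0 - D (((n + m : ℕ) : ℝ) * h))‖ ≤
        P.card * (P.card * (4 * ε)) := by
      refine (norm_sum_le_of_le P (f := fun n => ∑ m ∈ P, (D 0 - D (((n + m : ℕ) : ℝ) * h)))
        (n := fun _ => P.card * (4 * ε)) fun n hn => ?_).trans (by simp)
      refine (norm_sum_le_of_le P (n := fun _ => 4 * ε) fun m hm => ?_).trans (by simp)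
      have h2 := hPa m hm (n * h)
      have h3 := hPa n hn 0
      rw [zero_add, norm_sub_rev] at h3
      rw [← add_mul, norm_sub_rev] at h2
      push_cast
      have h4 := norm_add_le (D 0 - D (n * h)) (D (n * h) - D ((n + m) * h))
      rw [sub_add_sub_cancel] at h4
      linarith
    simp only [Finset.sum_sub_distrib, Finset.sum_const, nsmul_eq_mul] at h1
    have h2 := norm_sub_norm_le ((P.card : ℂ) * (P.card * D 0))
      (∑ n ∈ P, ∑ m ∈ P, D (((n + m : ℕ) : ℝ) * h))
    rw [norm_mul, norm_mul, norm_natCast, hε8] at h2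
    linarith
  have hPpos : (0 : ℝ) < P.card := by
    have : (0 : ℝ) < K := by positivity
    by_contra! hcon
    nlinarith
  have h1 := hlower.trans hupper
  have h2 : (P.card : ℝ) * (4 * ε) ≤ Real.pi / 2 * ((2 * K : ℕ) * (ω + ω)) :=
    le_of_mul_le_mul_right (by linarith) hPpos
  have h3 : Real.pi / 2 * ((2 * K : ℕ) * (ω + ω)) ≤ Real.pi * ε * P.card := by
    have : Real.pi / 2 * ((2 * K : ℕ) * (ω + ω)) = Real.pi * ε * (K / X.card) := by
      rw [hω]
      push_cast
      field_simp
      ring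
    rw [this]
    gcongr
    rw [div_le_iff₀' hXc]
    exact hPc
  have h4 : Real.pi * (ε * P.card) < 4 * (ε * P.card) := by
    have := Real.pi_lt_four
    gcongr
  linarith

/-- **Uniqueness theorem**: an almost periodic function all of whose Fourier coefficients vanish is
identically zero. -/
theorem HasTranslationNet.eq_zero (hD : HasTranslationNet D) (hc : Continuous D)
    (hx : ∀ x : ℝ, HasMean (fun t => D t * exp (-(I * x * t))) 0) (t : ℝ) : D t = 0 := by
  obtain ⟨B, -, hB⟩ := hD.exists_bound
  have := (hD.translate t).apply_zero_eq_zero (by fun_prop) fun x => by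
    simpa using (hx x).translate_fourier hc hB t
  simpa using this

end Window

lemma IsAlmostPeriodic.continuous_line {α β σ : ℝ} {f : ℂ → ℂ} (h : IsAlmostPeriodic α β f)
    (h₁ : α < σ) (h₂ : σ < β) : Continuous fun u : ℝ => f (σ + u * I) :=
  continuous_iff_continuousAt.mpr fun u =>
    ContinuousAt.comp (g := f) (f := fun u : ℝ => (σ : ℂ) + u * I)
      (h.1 _ (by simpa) (by simpa)).continuousAt (by fun_prop)

/-- Almost periodic functions are uniformly continuous in the vertical direction on reduced
strips. -/
lemma IsAlmostPeriodic.exists_modulus {α β σ₁ σ₂ : ℝ} {f : ℂ → ℂ} (h : IsAlmostPeriodic α β f)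
    (h₁ : α < σ₁) (h₁₂ : σ₁ ≤ σ₂) (h₂ : σ₂ < β) {ε : ℝ} (hε : 0 < ε) :
    ∃ δ > 0, ∀ σ ∈ Set.Icc σ₁ σ₂, ∀ u v : ℝ, |u - v| < δ →
      ‖f (σ + u * I) - f (σ + v * I)‖ ≤ ε := by
  obtain ⟨l, hl, hper⟩ := h.2 (ε / 3) (by positivity) σ₁ σ₂ h₁ h₁₂ h₂
  have hK : IsCompact (Set.Icc σ₁ σ₂ ×ℂ Set.Icc (-1) (l + 1)) :=
    isCompact_Icc.reProdIm isCompact_Icc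
  have hc : ContinuousOn f (Set.Icc σ₁ σ₂ ×ℂ Set.Icc (-1) (l + 1)) := fun s hs =>
    (h.1 s (h₁.trans_le hs.1.1) (hs.1.2.trans_lt h₂)).continuousAt.continuousWithinAt
  obtain ⟨δ, hδ, hu⟩ := Metric.uniformContinuousOn_iff.mp
    (hK.uniformContinuousOn_of_continuous hc) (ε / 3) (by positivity)
  refine ⟨min δ 1, by positivity, fun σ hσ u v huv => ?_⟩
  obtain ⟨τ, hτ, hτp⟩ := hper (-u)
  have huv' := abs_lt.mp (huv.trans_le (min_le_right _ _))
  have e : ∀ u : ℝ, (σ : ℂ) + u * I + I * τ = σ + ((u + τ : ℝ) : ℂ) * I := fun u => by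
    push_cast
    ring
  have m : ∀ w : ℝ, -1 ≤ w → w ≤ l + 1 →
      (σ : ℂ) + (w : ℂ) * I ∈ Set.Icc σ₁ σ₂ ×ℂ Set.Icc (-1) (l + 1) := fun w hw hw' => by
    simp only [mem_reProdIm, add_re, ofReal_re, mul_re, I_re, mul_zero, ofReal_im, I_im, mul_one,
      sub_self, add_zero, add_im, mul_im, zero_add]
    exact ⟨hσ, hw, hw'⟩
  have a1 := hτp (σ + u * I) (by simpa using hσ.1) (by simpa using hσ.2)
  have a2 := hτp (σ + v * I) (by simpa using hσ.1) (by simpa using hσ.2)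
  have a3 := hu _ (m (u + τ) (by linarith [hτ.1]) (by linarith [hτ.2]))
    _ (m (v + τ) (by linarith [hτ.1, huv'.2]) (by linarith [hτ.2, huv'.1])) (by
      rw [dist_eq_norm, add_sub_add_left_eq_sub, ← sub_mul, norm_mul, norm_I, mul_one,
        ← ofReal_sub, norm_real, Real.norm_eq_abs, add_sub_add_right_eq_sub]
      exact huv.trans_le (min_le_left _ _))
  rw [dist_eq_norm] at a3
  rw [e] at a1 a2
  rw [norm_sub_rev] at a1
  calc _ = ‖(f (σ + u * I) - f (σ + ((u + τ : ℝ) : ℂ) * I)) +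
        (f (σ + ((u + τ : ℝ) : ℂ) * I) - f (σ + ((v + τ : ℝ) : ℂ) * I)) +
        (f (σ + ((v + τ : ℝ) : ℂ) * I) - f (σ + v * I))‖ := by congr 1; ring
    _ ≤ ε / 3 + ε / 3 + ε / 3 := norm_add₃_le.trans (by gcongr)
    _ = ε := by ring

/-- The vertical translates of an almost periodic function form a totally bounded family on reduced
strips. -/
lemma IsAlmostPeriodic.exists_net {α β σ₁ σ₂ : ℝ} {f : ℂ → ℂ} (h : IsAlmostPeriodic α β f)
    (h₁ : α < σ₁) (h₁₂ : σ₁ ≤ σ₂) (h₂ : σ₂ < β) {ε : ℝ} (hε : 0 < ε) :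
    ∃ X : Finset ℝ, ∀ t : ℝ, ∃ x ∈ X, ∀ σ ∈ Set.Icc σ₁ σ₂, ∀ u : ℝ,
      ‖f (σ + ((u + t : ℝ) : ℂ) * I) - f (σ + ((u + x : ℝ) : ℂ) * I)‖ ≤ ε := by
  obtain ⟨l, hl, hper⟩ := h.2 (ε / 2) (by positivity) σ₁ σ₂ h₁ h₁₂ h₂
  obtain ⟨δ, hδ, hmod⟩ := h.exists_modulus h₁ h₁₂ h₂ (half_pos hε)
  obtain ⟨X, -, hXf, hX⟩ := (isCompact_Icc (a := (0 : ℝ)) (b := l)).finite_cover_balls hδ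
  refine ⟨hXf.toFinset, fun t => ?_⟩
  obtain ⟨τ, hτ, hτp⟩ := hper (-t)
  have ht : t + τ ∈ Set.Icc 0 l := ⟨by linarith [hτ.1], by linarith [hτ.2]⟩
  obtain ⟨x, hx, hxt⟩ := Set.mem_iUnion₂.mp (hX ht)
  refine ⟨x, by simpa using hx, fun σ hσ u => ?_⟩
  have a1 := hτp (σ + ((u + t : ℝ) : ℂ) * I) (by simpa using hσ.1) (by simpa using hσ.2)
  have a2 := hmod σ hσ (u + (t + τ)) (u + x) (by
    rw [add_sub_add_left_eq_sub, ← Real.dist_eq]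
    exact hxt)
  have e : (σ : ℂ) + ((u + t : ℝ) : ℂ) * I + I * τ = σ + ((u + (t + τ) : ℝ) : ℂ) * I := by
    push_cast
    ring
  rw [e, norm_sub_rev] at a1
  have := norm_add_le_of_le a1 a2
  rwa [sub_add_sub_cancel, add_halves] at this

lemma IsAlmostPeriodic.hasTranslationNet {α β σ : ℝ} {f : ℂ → ℂ} (h : IsAlmostPeriodic α β f)
    (h₁ : α < σ) (h₂ : σ < β) : HasTranslationNet fun u : ℝ => f (σ + u * I) := fun ε hε => by
  obtain ⟨X, hX⟩ := h.exists_net h₁ le_rfl h₂ hε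
  refine ⟨X, fun t => ?_⟩
  obtain ⟨x, hx, hxt⟩ := hX t
  exact ⟨x, hx, fun s => hxt σ ⟨le_rfl, le_rfl⟩ s⟩

/-- Uniform limits of functions with convergent mean values have mean values. -/
lemma HasMean.of_uniform_limit {U : Filter ℕ} [U.NeBot] {g : ℕ → ℝ → ℂ} {G : ℝ → ℂ} {c : ℕ → ℂ}
    {c' : ℂ} (hg : ∀ n, HasMean (g n) (c n)) (cg : ∀ n, Continuous (g n)) (cG : Continuous G)
    (h : ∀ ε > 0, ∀ᶠ n in U, ∀ t, ‖g n t - G t‖ ≤ ε) (hc : Tendsto c U (𝓝 c')) :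
    HasMean G c' := by
  refine Metric.tendsto_nhds.mpr fun ε hε => ?_
  obtain ⟨n, hn, hcn⟩ := ((h (ε / 3) (by positivity)).and
    (Metric.tendsto_nhds.mp hc (ε / 3) (by positivity))).exists
  filter_upwards [Metric.tendsto_nhds.mp (hg n) (ε / 3) (by positivity),
    eventually_gt_atTop 0] with T hT hT0
  have h1 := norm_mean_le hT0 hn
  rw [intervalIntegral.integral_sub ((cg n).intervalIntegrable _ _) (cG.intervalIntegrable _ _),
    mul_sub, norm_sub_rev, ← dist_eq_norm] at h1
  have := dist_triangle4 ((1 / (2 * (T : ℂ))) * ∫ t in (-T)..T, G t)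
    ((1 / (2 * (T : ℂ))) * ∫ t in (-T)..T, g n t) (c n) c'
  linarith

/-- Compactness of the family of translates: along an ultrafilter, translates converge uniformly. -/
lemma exists_translation_limit {S : Set ℝ} {F : ℝ → ℝ → ℂ}
    (hF : ∀ ε > 0, ∃ X : Finset ℝ, ∀ t : ℝ, ∃ x ∈ X, ∀ σ ∈ S, ∀ u : ℝ,
      ‖F σ (u + t) - F σ (u + x)‖ ≤ ε) (τ : ℕ → ℝ) (U : Ultrafilter ℕ) :
    ∃ G : ℝ → ℝ → ℂ, ∀ ε > 0, ∀ᶠ n in U, ∀ σ ∈ S, ∀ u : ℝ, ‖F σ (u + τ n) - G σ u‖ ≤ ε := by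
  have hlim : ∀ σ u : ℝ, ∃ z : ℂ, σ ∈ S → Tendsto (fun n => F σ (u + τ n)) U (𝓝 z) := by
    intro σ u
    by_cases hσ : σ ∈ S
    swap
    · exact ⟨0, fun h => absurd h hσ⟩
    have hnet : HasTranslationNet (F σ) := fun ε hε => by
      obtain ⟨X, hX⟩ := hF ε hε
      refine ⟨X, fun t => ?_⟩
      obtain ⟨x, hx, hxt⟩ := hX t
      exact ⟨x, hx, hxt σ hσ⟩
    obtain ⟨B, -, hB⟩ := hnet.exists_bound
    obtain ⟨z, -, hz⟩ := (isCompact_closedBall (0 : ℂ) B).ultrafilter_le_nhds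
      (U.map fun n => F σ (u + τ n)) (le_principal_iff.mpr
        (Filter.mem_map.mpr (Eventually.of_forall fun n => mem_closedBall_zero_iff.mpr (hB _))))
    exact ⟨z, fun _ => hz⟩
  choose G hG using hlim
  refine ⟨G, fun ε hε => ?_⟩
  obtain ⟨X, hX⟩ := hF (ε / 2) (by positivity)
  choose x hxX hx using hX
  have h1 : ∀ᶠ n in (U : Filter ℕ), ∃ y ∈ (X : Set ℝ), x (τ n) = y :=
    Eventually.of_forall fun n => ⟨_, hxX _, rfl⟩
  obtain ⟨y, -, hy⟩ := (Ultrafilter.eventually_exists_mem_iff X.finite_toSet).mp h1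
  have hclose : ∀ᶠ n in (U : Filter ℕ), ∀ σ ∈ S, ∀ u : ℝ,
      ‖F σ (u + τ n) - F σ (u + y)‖ ≤ ε / 2 := by
    filter_upwards [hy] with n hn
    rw [← hn]
    exact hx _
  filter_upwards [hclose] with n hn σ hσ u
  have h2 : ‖G σ u - F σ (u + y)‖ ≤ ε / 2 :=
    le_of_tendsto ((hG σ u hσ).sub_const _).norm (hclose.mono fun m hm => hm σ hσ u)
  rw [norm_sub_rev] at h2
  have := norm_add_le_of_le (hn σ hσ u) h2
  rwa [sub_add_sub_cancel, add_halves] at this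

/-- Uniform limits of translates inherit totally bounded translates. -/
lemma HasTranslationNet.of_uniform_limit {U : Filter ℕ} [U.NeBot] {F G : ℝ → ℂ} {τ : ℕ → ℝ}
    (hF : HasTranslationNet F) (h : ∀ ε > 0, ∀ᶠ n in U, ∀ u, ‖F (u + τ n) - G u‖ ≤ ε) :
    HasTranslationNet G := fun ε hε => by
  obtain ⟨n, hn⟩ := (h (ε / 3) (by positivity)).exists
  obtain ⟨X, hX⟩ := hF.translate (τ n) (ε / 3) (by positivity)
  refine ⟨X, fun t => ?_⟩
  obtain ⟨x, hx, hxt⟩ := hX t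
  refine ⟨x, hx, fun s => ?_⟩
  have h1 := hn (s + t)
  rw [norm_sub_rev] at h1
  have := norm_add_le_of_le (norm_add_le_of_le h1 (hxt s)) (hn (s + x))
  rw [sub_add_sub_cancel, sub_add_sub_cancel] at this
  linarith

lemma StarEquiv.symm {lam : ℕ → ℝ} {a b : ℕ → ℂ} (h : StarEquiv lam a b) : StarEquiv lam b a := by
  intro n hn
  obtain ⟨ψ, hψ⟩ := h n hn
  refine ⟨-ψ, fun j hj => ?_⟩
  rw [hψ j hj, mul_assoc, ← exp_add]
  simp

lemma StarEquiv.exists_tendsto {lam : ℕ → ℝ} {a b : ℕ → ℂ} (h : StarEquiv lam a b) :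
    ∃ τ : ℕ → ℝ, ∀ j, Tendsto (fun n => exp (I * lam j * τ n) * a j) atTop (𝓝 (b j)) := by
  have key : ∀ n : ℕ, ∃ τ : ℝ, ∀ j ≤ n, ‖exp (I * lam j * τ) * a j - b j‖ ≤ 1 / (n + 1) * ‖a j‖ := by
    intro n
    obtain ⟨ψ, hψ⟩ := h (n + 1) (by omega)
    set e : Fin (n + 1) → Submodule.span ℚ (lam '' {j : ℕ | j < n + 1}) := fun j =>
      ⟨lam j, Submodule.subset_span (Set.mem_image_of_mem lam j.2)⟩ with he
    obtain ⟨τ, hτ⟩ := kronecker_approx (fun j : Fin (n + 1) => lam j) (fun j => ψ (e j))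
      (fun k hk => by
        have h0 : ∑ j, k j • e j = 0 := by
          refine Subtype.ext ?_
          simpa [he] using hk
        have := congrArg ψ h0
        simpa using this) (ε := 1 / ((n : ℝ) + 1)) (by positivity)
    refine ⟨τ, fun j hj => ?_⟩
    have h1 := (hτ ⟨j, by omega⟩).le
    rw [hψ j (by omega), mul_comm, ← mul_sub, norm_mul, mul_comm, mul_assoc I]
    gcongr
  choose τ hτ using key
  refine ⟨τ, fun j => ?_⟩
  rw [tendsto_iff_norm_sub_tendsto_zero]
  refine squeeze_zero' (Eventually.of_forall fun _ => norm_nonneg _)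
    ((eventually_ge_atTop j).mono fun n hn => hτ n j hn) ?_
  simpa using (tendsto_one_div_add_atTop_nhds_zero_nat (𝕜 := ℝ)).mul_const ‖a j‖

/-- On reduced strips, `f₂` is uniformly approximated by vertical translates of `f₁`. -/
theorem exists_translate_approx {α β σ₁ σ₂ : ℝ} {f₁ f₂ : ℂ → ℂ} {lam : ℕ → ℝ} {a b : ℕ → ℂ}
    (hf₁ : IsAlmostPeriodic α β f₁) (hf₂ : IsAlmostPeriodic α β f₂)
    (hd₁ : HasDirichletSeries f₁ α β lam a) (hd₂ : HasDirichletSeries f₂ α β lam b)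
    (heq : StarEquiv lam a b) (h₁ : α < σ₁) (h₁₂ : σ₁ ≤ σ₂) (h₂ : σ₂ < β) {ε : ℝ} (hε : 0 < ε) :
    ∃ τ : ℝ, ∀ σ ∈ Set.Icc σ₁ σ₂, ∀ u : ℝ,
      ‖f₁ (σ + ((u + τ : ℝ) : ℂ) * I) - f₂ (σ + u * I)‖ ≤ ε := by
  obtain ⟨τ, hτ⟩ := heq.exists_tendsto
  obtain ⟨G, hG⟩ := exists_translation_limit (S := Set.Icc σ₁ σ₂)
    (F := fun σ u => f₁ (σ + u * I)) (fun ε hε => hf₁.exists_net h₁ h₁₂ h₂ hε) τ (hyperfilter ℕ)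
  have hU : ((hyperfilter ℕ : Ultrafilter ℕ) : Filter ℕ) ≤ atTop := by
    rw [← Nat.cofinite_eq_atTop]
    exact hyperfilter_le_cofinite
  suffices hGf : ∀ σ ∈ Set.Icc σ₁ σ₂, ∀ u : ℝ, G σ u = f₂ (σ + u * I) by
    obtain ⟨n, hn⟩ := (hG ε hε).exists
    exact ⟨τ n, fun σ hσ u => hGf σ hσ u ▸ hn σ hσ u⟩
  intro σ hσ u
  have hα : α < σ := h₁.trans_le hσ.1
  have hβ : σ < β := hσ.2.trans_lt h₂
  have c₁ := hf₁.continuous_line hα hβ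
  have c₂ := hf₂.continuous_line hα hβ
  have n₁ := hf₁.hasTranslationNet hα hβ
  have n₂ := hf₂.hasTranslationNet hα hβ
  have hGσ : ∀ ε > 0, ∀ᶠ n in (hyperfilter ℕ : Filter ℕ), ∀ u : ℝ,
      ‖f₁ (σ + ((u + τ n : ℝ) : ℂ) * I) - G σ u‖ ≤ ε :=
    fun ε hε => (hG ε hε).mono fun n hn => hn σ hσ
  have cG : Continuous (G σ) := by
    refine continuous_of_uniform_approx_of_continuous fun V hV => ?_
    obtain ⟨ε, hε, hV⟩ := Metric.mem_uniformity_dist.mp hV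
    obtain ⟨n, hn⟩ := (hGσ (ε / 2) (by positivity)).exists
    refine ⟨fun u => f₁ (σ + ((u + τ n : ℝ) : ℂ) * I), c₁.comp (continuous_add_const (τ n)),
      fun u => hV ?_⟩
    rw [dist_comm, dist_eq_norm]
    exact (hn u).trans_lt (by linarith)
  have nG : HasTranslationNet (G σ) := n₁.of_uniform_limit hGσ
  obtain ⟨B, -, hB⟩ := n₁.exists_bound
  have mG : ∀ (x : ℝ) (c c' : ℂ), HasMeanCoeff f₁ σ x c →
      Tendsto (fun n => exp (I * x * τ n) * c) (hyperfilter ℕ : Filter ℕ) (𝓝 c') →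
      HasMean (fun t => G σ t * exp (-(I * x * t))) c' := by
    intro x c c' hc hcc'
    refine HasMean.of_uniform_limit (U := (hyperfilter ℕ : Filter ℕ))
      (fun n => HasMean.translate_fourier hc c₁ hB (τ n)) (fun n => ?_) (by fun_prop) ?_ hcc'
    · exact (c₁.comp (continuous_add_const (τ n))).mul (by fun_prop)
    · intro ε hε
      filter_upwards [hGσ ε hε] with n hn t
      rw [← sub_mul, norm_mul, norm_exp_neg_I_mul, mul_one]
      exact hn t
  refine sub_eq_zero.mp ((nG.sub n₂).eq_zero (cG.sub c₂) (fun x => ?_) u)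
  have hcoef : ∃ c : ℂ, HasMean (fun t => G σ t * exp (-(I * x * t))) c ∧
      HasMeanCoeff f₂ σ x c := by
    by_cases hx : ∃ j, lam j = x
    · obtain ⟨j, rfl⟩ := hx
      refine ⟨_, mG _ _ _ ((hd₁ σ hα hβ).1 j) ?_, (hd₂ σ hα hβ).1 j⟩
      simpa only [mul_assoc] using ((hτ j).mono_left hU).mul_const (exp ((lam j : ℂ) * (σ : ℂ)))
    · have hx' := not_exists.mp hx
      refine ⟨0, mG _ _ _ ((hd₁ σ hα hβ).2 x hx') ?_, (hd₂ σ hα hβ).2 x hx'⟩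
      simp
  obtain ⟨c, m₁, m₂⟩ := hcoef
  have := HasMean.sub m₁ m₂ (by fun_prop) (c₂.mul (by fun_prop))
  simpa only [sub_self, ← sub_mul] using this

lemma valueSet_subset {α β : ℝ} {f₁ f₂ : ℂ → ℂ} {lam : ℕ → ℝ} {a b : ℕ → ℂ}
    (hf₁ : IsAlmostPeriodic α β f₁) (hf₂ : IsAlmostPeriodic α β f₂)
    (hd₁ : HasDirichletSeries f₁ α β lam a) (hd₂ : HasDirichletSeries f₂ α β lam b)
    (heq : StarEquiv lam a b) {E : Set ℝ} (hE : IsOpen E) (hEαβ : E ⊆ Set.Ioo α β) :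
    valueSet f₂ E ⊆ valueSet f₁ E := by
  rintro w ⟨σ₀, hσ₀, t₀, rfl⟩
  set s₀ : ℂ := σ₀ + t₀ * I with hs₀
  have hre : s₀.re = σ₀ := by simp [hs₀]
  obtain ⟨hα, hβ⟩ := hEαβ hσ₀
  have hopen : IsOpen {s : ℂ | α < s.re ∧ s.re < β} :=
    (isOpen_lt continuous_const continuous_re).inter (isOpen_lt continuous_re continuous_const)
  have han : ∀ f, IsAlmostPeriodic α β f → AnalyticOnNhd ℂ f {s : ℂ | α < s.re ∧ s.re < β} :=
    fun f hf => DifferentiableOn.analyticOnNhd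
      (fun s hs => (hf.1 s hs.1 hs.2).differentiableWithinAt) hopen
  have hpre : IsPreconnected {s : ℂ | α < s.re ∧ s.re < β} :=
    ((convex_halfSpace_re_gt α).inter (convex_halfSpace_re_lt β)).isPreconnected
  have hs₀m : s₀ ∈ {s : ℂ | α < s.re ∧ s.re < β} := by
    simp only [Set.mem_ofPred_eq, hre]
    exact ⟨hα, hβ⟩
  rcases (han f₂ hf₂ s₀ hs₀m).eventually_eq_or_eventually_ne
    (analyticAt_const (v := f₂ s₀)) with hconst | hne
  · have heqOn := (han f₂ hf₂).eqOn_of_preconnected_of_eventuallyEq analyticOnNhd_const hpre hs₀m hconst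
    refine ⟨σ₀, hσ₀, t₀, ?_⟩
    refine eq_of_forall_dist_le fun ε hε => ?_
    obtain ⟨τ, hτ⟩ := exists_translate_approx hf₁ hf₂ hd₁ hd₂ heq hα le_rfl hβ hε
    have h1 := hτ σ₀ ⟨le_rfl, le_rfl⟩ (t₀ - τ)
    rw [sub_add_cancel, heqOn (by simp [hα, hβ] : (σ₀ : ℂ) + ((t₀ - τ : ℝ) : ℂ) * I ∈ _)] at h1
    rwa [dist_eq_norm]
  · obtain ⟨r₁, hr₁, hE₁⟩ := Metric.isOpen_iff.mp hE σ₀ hσ₀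
    obtain ⟨r₂, hr₂, hne₂⟩ := Metric.mem_nhdsWithin_iff.mp hne
    obtain ⟨r, hr, hrr₁, hrr₂⟩ : ∃ r, 0 < r ∧ r < r₁ ∧ r < r₂ :=
      ⟨min r₁ r₂ / 2, by positivity, by have := min_le_left r₁ r₂; linarith [lt_min hr₁ hr₂],
        by have := min_le_right r₁ r₂; linarith [lt_min hr₁ hr₂]⟩
    have hIcc : Set.Icc (σ₀ - r) (σ₀ + r) ⊆ E := fun σ hσ => hE₁ <| by
      rw [Metric.mem_ball, Real.dist_eq, abs_lt]
      exact ⟨by linarith [hσ.1], by linarith [hσ.2]⟩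
    have hl := (hEαβ (hIcc ⟨le_rfl, by linarith⟩)).1
    have hu := (hEαβ (hIcc ⟨by linarith, le_rfl⟩)).2
    have hball : ∀ z ∈ Metric.closedBall s₀ r, z.re ∈ Set.Icc (σ₀ - r) (σ₀ + r) := by
      intro z hz
      have h1 := (abs_re_le_norm (z - s₀)).trans (mem_closedBall_iff_norm.mp hz)
      rw [sub_re, hre, abs_le] at h1
      exact ⟨by linarith, by linarith⟩
    have hdiff : ∀ (f : ℂ → ℂ), IsAlmostPeriodic α β f → ∀ (τ : ℝ), ∀ z ∈ Metric.closedBall s₀ r,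
        DifferentiableAt ℂ (fun z => f (z + τ * I)) z := by
      intro f hf τ z hz
      have h1 := hball z hz
      refine DifferentiableAt.comp (g := f) z (hf.1 _ ?_ ?_) (by fun_prop)
      · simpa using hl.trans_le h1.1
      · simpa using h1.2.trans_lt hu
    obtain ⟨m, hm, hmin⟩ : ∃ m > 0, ∀ z ∈ Metric.sphere s₀ r, m ≤ ‖f₂ z - f₂ s₀‖ := by
      have hc : ContinuousOn (fun z => ‖f₂ z - f₂ s₀‖) (Metric.sphere s₀ r) := by
        intro z hz
        have h1 := (hdiff f₂ hf₂ 0 z (Metric.sphere_subset_closedBall hz)).continuousAt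
        simp only [ofReal_zero, zero_mul, add_zero] at h1
        exact (h1.sub continuousAt_const).norm.continuousWithinAt
      obtain ⟨z₁, hz₁, hz₁m⟩ := (isCompact_sphere s₀ r).exists_isMinOn
        (NormedSpace.sphere_nonempty.mpr hr.le) hc
      refine ⟨_, norm_pos_iff.mpr (sub_ne_zero.mpr (hne₂ ⟨?_, ?_⟩)), fun z hz => hz₁m hz⟩
      · rw [Metric.mem_ball, Metric.mem_sphere.mp hz₁]
        exact hrr₂
      · rintro rfl
        simp at hz₁
        exact hr.ne hz₁
    obtain ⟨τ, hτ⟩ := exists_translate_approx hf₁ hf₂ hd₁ hd₂ heq hl (by linarith) hu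
      (ε := m / 8) (by positivity)
    have happ : ∀ z ∈ Metric.closedBall s₀ r, ‖f₁ (z + τ * I) - f₂ z‖ ≤ m / 8 := by
      intro z hz
      have h1 := hτ z.re (hball z hz) z.im
      rw [ofReal_add, add_mul, ← add_assoc, re_add_im] at h1
      exact h1
    have hdc : DiffContOnCl ℂ (fun z => f₁ (z + τ * I)) (Metric.ball s₀ r) := by
      refine DifferentiableOn.diffContOnCl fun z hz => ?_
      rw [closure_ball _ hr.ne'] at hz
      exact (hdiff f₁ hf₁ τ z hz).differentiableWithinAt
    have hs₀r : s₀ ∈ Metric.closedBall s₀ r := Metric.mem_closedBall_self hr.le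
    have hfar : ∀ z ∈ Metric.sphere s₀ r, m / 2 ≤ ‖f₁ (z + τ * I) - f₁ (s₀ + τ * I)‖ := by
      intro z hz
      have h1 := happ z (Metric.sphere_subset_closedBall hz)
      have h2 := happ s₀ hs₀r
      have h3 := hmin z hz
      rw [norm_sub_rev] at h1
      have h4 := norm_add₃_le (a := f₂ z - f₁ (z + τ * I))
        (b := f₁ (z + τ * I) - f₁ (s₀ + τ * I)) (c := f₁ (s₀ + τ * I) - f₂ s₀)
      rw [sub_add_sub_cancel, sub_add_sub_cancel] at h4
      linarith
    have hnonconst : ∃ᶠ z in 𝓝 s₀, f₁ (z + τ * I) ≠ f₁ (s₀ + τ * I) := by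
      intro hcon
      have hcon' : ∀ᶠ z in 𝓝 (s₀ + τ * I), f₁ z = f₁ (s₀ + τ * I) := by
        have h1 : Tendsto (fun z : ℂ => z - τ * I) (𝓝 (s₀ + τ * I)) (𝓝 s₀) :=
          (Continuous.tendsto (by fun_prop) _).trans_eq (by rw [add_sub_cancel_right])
        filter_upwards [h1.eventually hcon] with z hz
        simpa using hz
      have heqOn := (han f₁ hf₁).eqOn_of_preconnected_of_eventuallyEq analyticOnNhd_const hpre
        (by simpa [hs₀] using And.intro hα hβ) hcon'
      obtain ⟨z, hz⟩ := NormedSpace.sphere_nonempty (x := s₀).mpr hr.le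
      have h1 := hball z (Metric.sphere_subset_closedBall hz)
      have h2 := hfar z hz
      rw [heqOn (by simpa using And.intro (hl.trans_le h1.1) (h1.2.trans_lt hu) :
        z + τ * I ∈ {s : ℂ | α < s.re ∧ s.re < β}), sub_self, norm_zero] at h2
      linarith
    obtain ⟨z, hz, hzw⟩ := hdc.ball_subset_image_closedBall hr hfar hnonconst
      (show f₂ s₀ ∈ _ by
        rw [mem_ball_iff_norm, norm_sub_rev]
        linarith [happ s₀ hs₀r])
    refine ⟨z.re, hIcc (hball z hz), z.im + τ, ?_⟩
    rw [ofReal_add, add_mul, ← add_assoc, re_add_im]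
    exact hzw

end Auxiliary

/-- Main theorem, forward direction: `*∼`-equivalent almost periodic functions on a common
strip `U = {α < Re s < β}` take the same set of values on the strip over every open
`E ⊆ (α,β)`. -/
theorem equiv_implies_same_values (α β : ℝ) (f₁ f₂ : ℂ → ℂ) (lam : ℕ → ℝ) (a b : ℕ → ℂ)
    (h₁ : IsAlmostPeriodic α β f₁) (h₂ : IsAlmostPeriodic α β f₂)
    (hd₁ : HasDirichletSeries f₁ α β lam a) (hd₂ : HasDirichletSeries f₂ α β lam b)
    (heq : StarEquiv lam a b) :
    ∀ E : Set ℝ, IsOpen E → E ⊆ Set.Ioo α β → valueSet f₁ E = valueSet f₂ E := by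
  intro E hE hEαβ
  exact (valueSet_subset h₂ h₁ hd₂ hd₁ heq.symm hE hEαβ).antisymm
    (valueSet_subset h₁ h₂ hd₁ hd₂ heq hE hEαβ)
end
end
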